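/- arXiv:1404.1298 — 2 statements merged into one kernel-verified Lean document; each statement's English description precedes it below -/
import Mathlib

section
/- Let S ⊆ ℝ² be a nice shape and let X ⊆ ℝ² be a finite point set in general position with respect to S. Let Y ⊆ X be a subset such that no S-range S'' with X ∩ S'' = Y has three points of X on its boundary. If S₁ and S₂ are S-ranges with X ∩ S₁ = X ∩ S₂ = Y and |∂S₁ ∩ X| = |∂S₂ ∩ X| = 2, then ∂S₁ ∩ X = ∂S₂ ∩ X, i.e., all such representative S-ranges for Y have the same pair of points of X on their boundary. -/
open Set

noncomputable section

/-- The Euclidean plane. -/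
abbrev Pt : Type := EuclideanSpace ℝ (Fin 2)

/-- `T` is an `S`-range: a homothetic copy of `S` with positive ratio. -/
def IsRange (S T : Set Pt) : Prop :=
  ∃ (c : ℝ) (v : Pt), 0 < c ∧ T = (fun x => c • x + v) '' S

/-- A straight line in the plane. -/
def IsLine (l : Set Pt) : Prop :=
  ∃ (f : Pt →ₗ[ℝ] ℝ) (a : ℝ), f ≠ 0 ∧ l = {x | f x = a}

/-- A closed halfplane. -/
def IsClosedHalfplane (H : Set Pt) : Prop :=
  ∃ (f : Pt →ₗ[ℝ] ℝ) (a : ℝ), f ≠ 0 ∧ H = {x | f x ≤ a}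

/-- An open halfplane bounded by the line through `p` and `q`. -/
def IsOpenHalfplaneOf (p q : Pt) (L : Set Pt) : Prop :=
  ∃ (f : Pt →ₗ[ℝ] ℝ) (a : ℝ), f ≠ 0 ∧ f p = a ∧ f q = a ∧ L = {x | a < f x}

/-- `S` is a nice shape: a non-empty convex compact set such that every boundary
point has exactly one touching line and the boundary contains no non-trivial
straight line segment. -/
def NiceShape (S : Set Pt) : Prop :=
  S.Nonempty ∧ Convex ℝ S ∧ IsCompact S ∧
  (∀ p ∈ frontier S, ∃! l : Set Pt, IsLine l ∧ l ∩ S = {p}) ∧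
  (∀ x ∈ frontier S, ∀ y ∈ frontier S, segment ℝ x y ⊆ frontier S → x = y)

/-- No four points of `A` lie on the boundary of a common `S`-range. -/
def NoFourOnBoundary (S A : Set Pt) : Prop :=
  ∀ T : Set Pt, IsRange S T →
    ∀ p₁ p₂ p₃ p₄ : Pt, p₁ ∈ A ∩ frontier T → p₂ ∈ A ∩ frontier T →
      p₃ ∈ A ∩ frontier T → p₄ ∈ A ∩ frontier T →
      p₁ ≠ p₂ → p₁ ≠ p₃ → p₁ ≠ p₄ → p₂ ≠ p₃ → p₂ ≠ p₄ → p₃ ≠ p₄ → False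

/-- `X` is in general position with respect to `S`: no two points on a vertical
line, no three points collinear, and no four points on the boundary of a common
`S`-range. -/
def GenPos (S : Set Pt) (X : Finset Pt) : Prop :=
  (∀ p ∈ X, ∀ q ∈ X, p ≠ q → p 0 ≠ q 0) ∧
  (∀ p ∈ X, ∀ q ∈ X, ∀ r ∈ X, p ≠ q → p ≠ r → q ≠ r →
    ¬ Collinear ℝ ({p, q, r} : Set Pt)) ∧
  NoFourOnBoundary S ↑X

/-- The hyperedges of the `k`-uniform `S`-capturing hypergraph on `X`:
`k`-element subsets of `X` captured by some `S`-range. -/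
def capturedSets (S : Set Pt) (X : Finset Pt) (k : ℕ) : Set (Set Pt) :=
  {Y | Y ⊆ ↑X ∧ Y.ncard = k ∧ ∃ T : Set Pt, IsRange S T ∧ ↑X ∩ T = Y}

/-- The `i`-sets of `X`: `i`-element subsets of `X` separable by a straight line,
i.e. captured by a closed halfplane.  `aᵢ` is the number of such sets. -/
def iSets (X : Finset Pt) (i : ℕ) : Set (Set Pt) :=
  {Y | Y ⊆ ↑X ∧ Y.ncard = i ∧ ∃ H : Set Pt, IsClosedHalfplane H ∧ ↑X ∩ H = Y}

/-- `𝒜ᵢ`: closed halfplanes containing exactly `i` points of `X`, exactly two of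
which lie on the boundary line. -/
def repHalfplanes (X : Finset Pt) (i : ℕ) : Set (Set Pt) :=
  {H | IsClosedHalfplane H ∧ ((↑X : Set Pt) ∩ H).ncard = i ∧
    ((↑X : Set Pt) ∩ frontier H).ncard = 2}

/-- `𝒮_pq`: the `S`-ranges having both `p` and `q` on their boundary. -/
def rangesThrough (S : Set Pt) (p q : Pt) : Set (Set Pt) :=
  {T | IsRange S T ∧ p ∈ frontier T ∧ q ∈ frontier T}

/-- The ranges in `𝒮_pq` that come strictly after `S₁` (w.r.t. `≺`, i.e. inclusion
of the intersections with `L`) and have a point of `X` on their boundary that is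
not on the boundary of `S₁`. -/
def nextCandidates (S : Set Pt) (p q : Pt) (L : Set Pt) (X : Finset Pt) (S₁ : Set Pt) :
    Set (Set Pt) :=
  {S₂ | S₂ ∈ rangesThrough S p q ∧ S₁ ∩ L ⊂ S₂ ∩ L ∧
    ((frontier S₂ \ frontier S₁) ∩ ↑X).Nonempty}

/-- `ℛ₁ᵏ`: Type I ranges, i.e. `S`-ranges containing exactly `k` points of `X`,
exactly three of which are on the boundary. -/
def typeIRanges (S : Set Pt) (X : Finset Pt) (k : ℕ) : Set (Set Pt) :=
  {T | IsRange S T ∧ ((↑X : Set Pt) ∩ T).ncard = k ∧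
    ((↑X : Set Pt) ∩ frontier T).ncard = 3}

/-- `ℛ(Y)`: the Type I representative ranges of `Y`. -/
def repRanges (S : Set Pt) (X : Finset Pt) (Y : Set Pt) : Set (Set Pt) :=
  {T | IsRange S T ∧ ↑X ∩ T = Y ∧ ((↑X : Set Pt) ∩ frontier T).ncard = 3}

/-- `ℰ₁ᵏ`: Type I hyperedges. -/
def typeIEdges (S : Set Pt) (X : Finset Pt) (k : ℕ) : Set (Set Pt) :=
  {Y | Y ⊆ ↑X ∧ Y.ncard = k ∧ (repRanges S X Y).Nonempty}

/-- `ℰ₂ᵏ`: Type II hyperedges, captured by some `S`-range but by no `S`-range with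
three points of `X` on its boundary. -/
def typeIIEdges (S : Set Pt) (X : Finset Pt) (k : ℕ) : Set (Set Pt) :=
  {Y | Y ∈ capturedSets S X k ∧ ¬ (repRanges S X Y).Nonempty}

lemma NiceShape.strictConvex {S : Set Pt} (hS : NiceShape S) : StrictConvex ℝ S := by
  obtain ⟨-, hconv, hcomp, -, hseg⟩ := hS
  intro x hx y hy hxy a b ha hb hab
  by_contra hz
  have hfr : ∀ w ∈ S, w ∉ interior S → w ∈ frontier S := fun w hw hw' =>
    ⟨subset_closure hw, hw'⟩
  suffices H : ∀ w ∈ segment ℝ x y, w ∉ interior S from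
    hxy (hseg x (hfr x hx (H x (left_mem_segment ℝ x y))) y
      (hfr y hy (H y (right_mem_segment ℝ x y)))
      fun w hw => hfr w (hconv.segment_subset hx hy hw) (H w hw))
  rcases (interior S).eq_empty_or_nonempty with hem | hne
  · simp [hem]
  obtain ⟨f, hf⟩ := geometric_hahn_banach_open_point hconv.interior isOpen_interior hz
  have hle : ∀ w ∈ S, f w ≤ f (a • x + b • y) := by
    intro w hw
    have hw' : w ∈ closure (interior S) := by
      rw [hconv.closure_interior_eq_closure_of_nonempty_interior hne]
      exact subset_closure hw
    exact closure_minimal (fun u hu => (hf u hu).le)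
      (isClosed_le f.continuous continuous_const) hw'
  have hfx := hle x hx
  have hfy := hle y hy
  simp only [map_add, map_smul, smul_eq_mul] at hf hfx hfy
  have hxy' : f x = f y := by
    obtain rfl : a = 1 - b := by linarith
    apply le_antisymm <;> nlinarith
  rintro w ⟨s, t, hs, ht, hst, rfl⟩ hw
  have := hf _ hw
  simp only [map_add, map_smul, smul_eq_mul, hxy', ← add_mul, hst, hab] at this
  exact lt_irrefl _ this

open Pointwise in
lemma IsRange.strictConvex {S T : Set Pt} (hT : IsRange S T) (hS : StrictConvex ℝ S) :
    StrictConvex ℝ T := by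
  obtain ⟨c, v, hc, rfl⟩ := hT
  have h : (fun x => c • x + v) '' S = v +ᵥ c • S := by
    rw [← image_vadd, ← image_smul, image_image]
    simp only [vadd_eq_add, add_comm v]
  exact h ▸ hS.affinity v c

lemma IsRange.isCompact {S T : Set Pt} (hT : IsRange S T) (hS : IsCompact S) :
    IsCompact T := by
  obtain ⟨c, v, hc, rfl⟩ := hT
  exact hS.image (by fun_prop)

/-- Preimages under homotheties of positive ratio are again ranges. -/
lemma IsRange.preimage {S T : Set Pt} (hT : IsRange S T) {μ : ℝ} (hμ : 0 < μ) (w : Pt) :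
    IsRange S ((fun z => μ • z + w) ⁻¹' T) := by
  obtain ⟨c, v, hc, rfl⟩ := hT
  refine ⟨c / μ, μ⁻¹ • (v - w), by positivity, ?_⟩
  ext z
  simp only [mem_preimage, mem_image]
  refine exists_congr fun x => and_congr_right fun _ => ⟨fun h => ?_, fun h => ?_⟩
  · have hz : z = μ⁻¹ • (μ • z) := by rw [smul_smul, inv_mul_cancel₀ hμ.ne', one_smul]
    rw [hz, eq_sub_of_add_eq h.symm]
    module
  · rw [← h]
    match_scalars <;> field_simp
    ring

/-- Two ranges of the same shape are related by a homothety of positive ratio. -/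
lemma IsRange.exists_preimage_eq {S T U : Set Pt} (hT : IsRange S T) (hU : IsRange S U) :
    ∃ (μ : ℝ) (w : Pt), 0 < μ ∧ U = (fun z => μ • z + w) ⁻¹' T := by
  obtain ⟨c, v, hc, rfl⟩ := hT
  obtain ⟨c', v', hc', rfl⟩ := hU
  refine ⟨c / c', v - (c / c') • v', by positivity, ?_⟩
  ext z
  simp only [mem_preimage, mem_image]
  refine exists_congr fun x => and_congr_right fun _ => ⟨fun h => ?_, fun h => ?_⟩
  · rw [← h]
    match_scalars <;> field_simp
    ring
  · have hz : z = (c' / c) • ((c / c') • z) := by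
      rw [smul_smul, div_mul_div_cancel₀ hc.ne', div_self hc'.ne', one_smul]
    have h' : (c / c') • z = c • x + v - (v - (c / c') • v') := by rw [h]; abel
    rw [hz, h']
    match_scalars <;> field_simp
    ring

lemma interior_homothety_preimage (T : Set Pt) {μ : ℝ} (hμ : 0 < μ) (w : Pt) :
    interior ((fun z => μ • z + w) ⁻¹' T) = (fun z => μ • z + w) ⁻¹' interior T :=
  (((Homeomorph.smulOfNeZero μ hμ.ne').trans (Homeomorph.addRight w)).preimage_interior T).symm

lemma StrictConvex.combo_mem_interior {T : Set Pt} (hT : StrictConvex ℝ T) {x y z : Pt}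
    (hx : x ∈ T) (hy : y ∈ T) {a b : ℝ} (ha : 0 < a) (hb : 0 < b) (hab : a + b = 1)
    (hz : z = a • x + b • y) (hne : z ≠ x) : z ∈ interior T := by
  rw [hz]
  refine hT hx hy ?_ ha hb hab
  rintro rfl
  exact hne (by rw [hz, ← add_smul, hab, one_smul])

lemma StrictConvex.combo_three_mem_interior {T : Set Pt} (hT : StrictConvex ℝ T)
    {x y w z : Pt} (hx : x ∈ T) (hy : y ∈ T) (hw : w ∈ T) {a b c : ℝ} (ha : 0 < a)
    (hb : 0 ≤ b) (hc : 0 < c) (habc : a + b + c = 1) (hz : z = a • x + b • y + c • w)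
    (hne : z ≠ x) : z ∈ interior T := by
  have hbc : 0 < b + c := by positivity
  refine hT.combo_mem_interior (y := (b / (b + c)) • y + (c / (b + c)) • w) hx
    (hT.convex hy hw (by positivity) (by positivity) (by field_simp)) ha hbc (by linarith) ?_ hne
  rw [hz]
  match_scalars <;> field_simp

/-- A linear coordinate system `(g, f)` of the plane with respect to the basis `(d, n)`. -/
structure IsCoord (g f : Pt →ₗ[ℝ] ℝ) (d n : Pt) : Prop where
  g_d : g d = 1
  g_n : g n = 0
  f_d : f d = 0
  f_n : f n = 1
  eq_add : ∀ z, z = g z • d + f z • n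

lemma exists_isCoord {d : Pt} (hd : d ≠ 0) :
    ∃ (g f : Pt →ₗ[ℝ] ℝ) (n : Pt), IsCoord g f d n := by
  have hN : 0 < d 0 ^ 2 + d 1 ^ 2 := by
    by_contra h
    have h0 : d 0 = 0 := by nlinarith [sq_nonneg (d 0), sq_nonneg (d 1)]
    have h1 : d 1 = 0 := by nlinarith [sq_nonneg (d 0), sq_nonneg (d 1)]
    exact hd (by ext i; fin_cases i <;> simp [h0, h1])
  set N := d 0 ^ 2 + d 1 ^ 2 with hNdef
  let e : Fin 2 → Pt →ₗ[ℝ] ℝ := fun i => (EuclideanSpace.proj i : Pt →L[ℝ] ℝ).toLinearMap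
  have he : ∀ i z, e i z = z i := fun i z => rfl
  refine ⟨(d 0 / N) • e 0 + (d 1 / N) • e 1, (d 0 / N) • e 1 - (d 1 / N) • e 0,
    !₂[-d 1, d 0], ?_, ?_, ?_, ?_, ?_⟩
  · simp [he]; field_simp; rw [hNdef]
  · simp [he]; ring
  · simp [he]; ring
  · simp [he]; field_simp; rw [hNdef]
  · intro z
    ext i
    fin_cases i
    · simp [he]; field_simp; rw [hNdef]; ring
    · simp [he]; field_simp; rw [hNdef]; ring

lemma IsCoord.flip {g f : Pt →ₗ[ℝ] ℝ} {d n : Pt} (h : IsCoord g f d n) :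
    IsCoord g (-f) d (-n) :=
  ⟨h.g_d, by simp [h.g_n], by simp [h.f_d], by simp [h.f_n], fun z => by
    simpa using h.eq_add z⟩

lemma IsCoord.reverse {g f : Pt →ₗ[ℝ] ℝ} {d n : Pt} (h : IsCoord g f d n) :
    IsCoord (-g) f (-d) n :=
  ⟨by simp [h.g_d], by simp [h.g_n], by simp [h.f_d], h.f_n, fun z => by
    simpa using h.eq_add z⟩

/-- The line through two boundary points meets a strictly convex set in the chord. -/
lemma StrictConvex.exists_chord_param {T : Set Pt} (hT : StrictConvex ℝ T)
    {g f : Pt →ₗ[ℝ] ℝ} {p q n : Pt} (hc : IsCoord g f (q - p) n)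
    (hp : p ∈ T) (hq : q ∈ T) (hp' : p ∉ interior T) (hq' : q ∉ interior T)
    {z : Pt} (hz : z ∈ T) (hfz : f z = f p) :
    ∃ t : ℝ, 0 ≤ t ∧ t ≤ 1 ∧ z = p + t • (q - p) := by
  have hpq : q - p ≠ 0 := fun h => by simpa [h] using hc.g_d
  obtain ⟨t, ht⟩ : ∃ t : ℝ, z = p + t • (q - p) := by
    refine ⟨g (z - p), ?_⟩
    have := hc.eq_add (z - p)
    rw [map_sub f, hfz, sub_self, zero_smul, add_zero] at this
    rw [← this]; abel
  refine ⟨t, ?_, ?_, ht⟩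
  · by_contra! h
    have h1 : 0 < 1 - t := by linarith
    refine hp' (hT.combo_mem_interior (a := 1 / (1 - t)) (b := -t / (1 - t)) hz hq
      (by positivity) (div_pos (by linarith) h1) (by field_simp; ring) ?_ ?_)
    · rw [ht]; match_scalars <;> field_simp <;> ring
    · intro hpz
      rw [ht, left_eq_add, smul_eq_zero] at hpz
      exact hpz.elim h.ne hpq
  · by_contra! h
    have h1 : 0 < t := by linarith
    refine hq' (hT.combo_mem_interior (a := 1 / t) (b := (t - 1) / t) hz hp
      (by positivity) (div_pos (by linarith) h1) (by field_simp; ring) ?_ ?_)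
    · rw [ht]; match_scalars <;> field_simp; ring
    · intro hpz
      have : (t - 1) • (q - p) = 0 := by
        rw [ht] at hpz
        rw [sub_smul, one_smul, sub_eq_zero, ← add_right_inj p, ← hpz]; abel
      rw [smul_eq_zero] at this
      exact this.elim (fun h' => by linarith) hpq

/-- If a homothety of positive ratio maps two boundary points `p`, `q` of a strictly convex
set `T` into `T`, then it is the identity or maps one of the two sides of `T` determined by
the line through `p` and `q` into the interior of `T`. -/
lemma StrictConvex.homothety_side_subset_interior {T : Set Pt} (hT : StrictConvex ℝ T)
    {g f : Pt →ₗ[ℝ] ℝ} {p q n : Pt} (hc : IsCoord g f (q - p) n)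
    (hp : p ∈ T) (hq : q ∈ T) (hp' : p ∉ interior T) (hq' : q ∉ interior T)
    {μ : ℝ} (hμ : 0 < μ) {w : Pt} (hP : μ • p + w ∈ T) (hQ : μ • q + w ∈ T) :
    (μ = 1 ∧ w = 0) ∨ (∀ z ∈ T, f p < f z → μ • z + w ∈ interior T) ∨
      (∀ z ∈ T, f z < f p → μ • z + w ∈ interior T) := by
  have hfpq : f q = f p := by
    have := hc.f_d
    rw [map_sub] at this
    linarith
  by_cases he : f (μ • p + w) = f p
  · obtain ⟨s, hs0, hs1, hs⟩ := hT.exists_chord_param hc hp hq hp' hq' hP he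
    have he' : f (μ • q + w) = f p := by
      rw [← he]
      simp [hfpq]
    obtain ⟨t, ht0, ht1, ht⟩ := hT.exists_chord_param hc hp hq hp' hq' hQ he'
    have hts : t - s = μ := by
      have h1 : (t - s) • (q - p) = μ • (q - p) := by
        linear_combination (norm := module) hs - ht
      have := congrArg g h1
      simpa only [map_smul, hc.g_d, smul_eq_mul, mul_one] using this
    have hw : w = (1 - μ) • p + s • (q - p) := by
      linear_combination (norm := module) hs
    rcases eq_or_ne μ 1 with h1 | h1
    · left
      obtain rfl : s = 0 := by linarith
      exact ⟨h1, by rw [hw, h1]; module⟩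
    · have h2 : 0 < 1 - μ := by
        have : μ ≤ 1 := by linarith
        exact sub_pos.2 (lt_of_le_of_ne this h1)
      have key : ∀ z ∈ T, f z ≠ f p → μ • z + w ∈ interior T := by
        intro z hz hfz
        have ho : (1 - s / (1 - μ)) • p + (s / (1 - μ)) • q ∈ T := by
          refine hT.convex hp hq ?_ (by positivity) (by ring)
          rw [sub_nonneg, div_le_one h2]
          linarith
        have hwo : w = (1 - μ) • ((1 - s / (1 - μ)) • p + (s / (1 - μ)) • q) := by
          rw [hw]
          match_scalars <;> field_simp
          ring
        rw [hwo]
        refine hT hz ho ?_ hμ h2 (by ring)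
        rintro rfl
        apply hfz
        simp only [map_add, map_smul, smul_eq_mul, hfpq]
        ring
      exact Or.inr (Or.inl fun z hz h => key z hz h.ne')
  · have key : ∀ z ∈ T, 0 < (f z - f p) / (f p - f (μ • p + w)) →
        μ • z + w ∈ interior T := by
      intro z hz hg
      set k := (f z - f p) / (f p - f (μ • p + w)) with hk
      have hden : f p - f (μ • p + w) ≠ 0 := sub_ne_zero.2 (Ne.symm he)
      have hfz : f z ≠ f p := by
        intro h
        simp [hk, h] at hg
      obtain ⟨b, hb⟩ : ∃ b : ℝ, z = p + b • (q - p) - k • (μ • p + w - p) := by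
        refine ⟨g (z - p + k • (μ • p + w - p)), ?_⟩
        have h0 : f (z - p + k • (μ • p + w - p)) = 0 := by
          rw [map_add, map_sub, map_smul, map_sub, smul_eq_mul, hk]
          field_simp
          ring
        have := hc.eq_add (z - p + k • (μ • p + w - p))
        rw [h0, zero_smul, add_zero] at this
        rw [← this]
        abel
      have hzp : p ≠ z := by
        rintro rfl
        exact hfz rfl
      have hzq : q ≠ z := by
        rintro rfl
        exact hfz hfpq
      have hb0 : 0 < b := by
        by_contra! hb0
        have hk1 : 0 < 1 - b + k := by linarith
        refine hp' (hT.combo_three_mem_interior (a := 1 / (1 - b + k))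
          (b := -b / (1 - b + k)) (c := k / (1 - b + k)) hz hq hP (by positivity)
          (div_nonneg (by linarith) hk1.le) (by positivity) (by field_simp; ring) ?_ hzp)
        rw [hb]
        match_scalars <;> field_simp <;> ring
      have ha0 : 0 < 1 - b + k * (1 - μ) := by
        by_contra! ha0
        have hk1 : 0 < b + k * μ := by nlinarith
        refine hq' (hT.combo_three_mem_interior (a := 1 / (b + k * μ))
          (b := -(1 - b + k * (1 - μ)) / (b + k * μ)) (c := k / (b + k * μ)) hz hp hQ
          (by positivity) (div_nonneg (by linarith) hk1.le) (by positivity)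
          (by field_simp; ring) ?_ hzq)
        rw [hb]
        match_scalars <;> field_simp <;> ring
      refine hT.combo_three_mem_interior (a := (1 - b + k * (1 - μ)) / (1 + k))
        (b := b / (1 + k)) (c := k * μ / (1 + k)) hP hQ hz (by positivity) (by positivity)
        (by positivity) (by field_simp; ring) ?_ ?_
      · rw [hb]
        match_scalars <;> field_simp <;> ring
      · intro h
        exact hzp (smul_right_injective _ hμ.ne' (add_right_cancel h)).symm
    rcases lt_or_gt_of_ne he with h | h
    · exact Or.inr (Or.inl fun z hz hfz =>
        key z hz (div_pos (sub_pos.2 hfz) (sub_pos.2 h)))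
    · exact Or.inr (Or.inr fun z hz hfz =>
        key z hz (div_pos_of_neg_of_neg (sub_neg.2 hfz) (sub_neg.2 h)))

/-- If two boundary points `p`, `q` of a range `T` belong to a range `U`, then `U` is `T` or
contains in its interior one of the two sides of `T` determined by the line through
`p` and `q`. -/
lemma IsRange.side_subset_interior {S T U : Set Pt} (hS : StrictConvex ℝ S)
    (hT : IsRange S T) (hU : IsRange S U) {g f : Pt →ₗ[ℝ] ℝ} {p q n : Pt}
    (hc : IsCoord g f (q - p) n) (hp : p ∈ T) (hq : q ∈ T) (hp' : p ∉ interior T)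
    (hq' : q ∉ interior T) (hpU : p ∈ U) (hqU : q ∈ U) :
    U = T ∨ (∀ z ∈ T, f p < f z → z ∈ interior U) ∨
      (∀ z ∈ T, f z < f p → z ∈ interior U) := by
  obtain ⟨μ, w, hμ, rfl⟩ := hT.exists_preimage_eq hU
  rw [interior_homothety_preimage T hμ w]
  refine ((hT.strictConvex hS).homothety_side_subset_interior hc hp hq hp' hq' hμ
    hpU hqU).imp_left ?_
  rintro ⟨rfl, rfl⟩
  simp

/-- The left endpoint of the section of a compact convex set by a line `f = h`, as a
continuous function of `h`. -/
lemma exists_section_left_endpoint {K : Set Pt} (hK : Convex ℝ K) (hcK : IsCompact K)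
    {g f : Pt →ₗ[ℝ] ℝ} {d n : Pt} (hc : IsCoord g f d n) {b t : Pt} (hb : b ∈ K) (ht : t ∈ K) :
    ∃ α : ℝ → ℝ, ContinuousOn α (Ioo (f b) (f t)) ∧ ∀ h ∈ Ioo (f b) (f t),
      α h • d + h • n ∈ K ∧ ∀ x : ℝ, x • d + h • n ∈ K → α h ≤ x := by
  let s : ℝ → Set ℝ := fun h => {x | x • d + h • n ∈ K}
  have hbdd : ∀ h, BddBelow (s h) := by
    intro h
    have hg : Continuous g := g.continuous_of_finiteDimensional
    refine (hcK.image hg).bddBelow.mono ?_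
    intro x hx
    exact ⟨_, hx, by simp [hc.g_d, hc.g_n]⟩
  have hclosed : ∀ h, IsClosed (s h) := fun h =>
    hcK.isClosed.preimage (f := fun x : ℝ => x • d + h • n) (by fun_prop)
  have hne : ∀ h ∈ Ioo (f b) (f t), (s h).Nonempty := by
    rintro h ⟨h1, h2⟩
    have h3 : 0 < f t - f b := by linarith
    set r := (h - f b) / (f t - f b) with hr
    have hr0 : 0 ≤ r := div_nonneg (by linarith) h3.le
    have hr1 : r ≤ 1 := by
      rw [hr, div_le_one h3]
      linarith
    have hm := hK hb ht (sub_nonneg.2 hr1) hr0 (by ring)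
    refine ⟨g ((1 - r) • b + r • t), ?_⟩
    have hf : f ((1 - r) • b + r • t) = h := by
      simp only [map_add, map_smul, smul_eq_mul, hr]
      field_simp
      ring
    rw [hc.eq_add ((1 - r) • b + r • t), hf] at hm
    exact hm
  have hmem : ∀ h ∈ Ioo (f b) (f t), sInf (s h) ∈ s h := fun h hh =>
    (hclosed h).csInf_mem (hne h hh) (hbdd h)
  refine ⟨fun h => sInf (s h), ?_, fun h hh => ⟨hmem h hh, fun x hx => csInf_le (hbdd h) hx⟩⟩
  have hconv : ConvexOn ℝ (Ioo (f b) (f t)) fun h => sInf (s h) := by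
    refine ⟨convex_Ioo _ _, fun x hx y hy a c ha hc' hac => csInf_le (hbdd _) ?_⟩
    have := hK (hmem x hx) (hmem y hy) ha hc' hac
    change _ ∈ K
    convert this using 1
    simp only [smul_eq_mul]
    module
  simpa [interior_Ioo] using hconv.continuousOn_interior

lemma notMem_interior_of_forall_le {K : Set Pt} {d n : Pt} {a h : ℝ}
    (ha : ∀ x : ℝ, x • d + h • n ∈ K → a ≤ x) : a • d + h • n ∉ interior K := by
  intro hmem
  have hcont : Continuous fun x : ℝ => x • d + h • n := by fun_prop
  have hev := hcont.continuousAt.preimage_mem_nhds (isOpen_interior.mem_nhds hmem)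
  obtain ⟨l, hl, hsub⟩ := exists_Ioc_subset_of_mem_nhds hev ⟨a - 1, by linarith⟩
  have := ha ((l + a) / 2) (interior_subset (hsub ⟨by linarith, by linarith⟩))
  linarith

lemma exists_pos_add_smul_mem {K : Set Pt} {c : Pt} (hcK : c ∈ interior K) (v : Pt) :
    ∃ ε : ℝ, 0 < ε ∧ c + ε • v ∈ K := by
  have hcont : Continuous fun x : ℝ => c + x • v := by fun_prop
  have hev := hcont.continuousAt.preimage_mem_nhds (x := 0)
    (isOpen_interior.mem_nhds (by simpa using hcK))
  obtain ⟨l, hl, hsub⟩ := exists_Ico_subset_of_mem_nhds hev ⟨1, one_pos⟩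
  exact ⟨l / 2, by linarith, interior_subset (hsub ⟨by linarith, by linarith⟩)⟩

/-- The chords of a strictly convex compact set parallel to the chord `pq`, on one side of
`pq`, as a continuous family: `u h` is an endpoint and `l h` the ratio of lengths. -/
lemma exists_parallel_chords {K : Set Pt} (hK : StrictConvex ℝ K) (hcK : IsCompact K)
    {g f : Pt →ₗ[ℝ] ℝ} {p q n : Pt} (hc : IsCoord g f (q - p) n)
    (hp : p ∈ K) (hq : q ∈ K) (hp' : p ∉ interior K) (hq' : q ∉ interior K)
    {t : Pt} (ht : t ∈ K) :
    ∃ (l : ℝ → ℝ) (u : ℝ → Pt), (∀ h ∈ Ico (f p) (f t), ContinuousAt l h ∧ ContinuousAt u h) ∧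
      (f p < f t → l (f p) = 1 ∧ u (f p) = p) ∧
      ∀ h ∈ Ico (f p) (f t), 0 < l h ∧ f (u h) = h ∧ u h ∈ K ∧ u h ∉ interior K ∧
        u h + l h • (q - p) ∈ K ∧ u h + l h • (q - p) ∉ interior K := by
  have hpq : p ≠ q := by
    rintro rfl
    simpa using hc.g_d
  have hfpq : f q = f p := by
    have := hc.f_d
    rw [map_sub] at this
    linarith
  have hgpq : g q = g p + 1 := by
    have := hc.g_d
    rw [map_sub] at this
    linarith
  have hmid : (1 / 2 : ℝ) • p + (1 / 2 : ℝ) • q ∈ interior K :=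
    hK hp hq hpq (by norm_num) (by norm_num) (by norm_num)
  have hfmid : f ((1 / 2 : ℝ) • p + (1 / 2 : ℝ) • q) = f p := by
    simp only [map_add, map_smul, smul_eq_mul, hfpq]
    ring
  obtain ⟨b, hb, hfb⟩ : ∃ b ∈ K, f b < f p := by
    obtain ⟨ε, hε, hmem⟩ := exists_pos_add_smul_mem hmid (-n)
    refine ⟨_, hmem, ?_⟩
    rw [map_add, hfmid, map_smul, map_neg, hc.f_n, smul_eq_mul]
    linarith
  obtain ⟨α, hαc, hα⟩ := exists_section_left_endpoint hK.convex hcK hc hb ht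
  obtain ⟨β, hβc, hβ⟩ := exists_section_left_endpoint hK.convex hcK hc.reverse hb ht
  have hsub : ∀ h ∈ Ico (f p) (f t), h ∈ Ioo (f b) (f t) := fun h hh =>
    ⟨hfb.trans_le hh.1, hh.2⟩
  have hv : ∀ h, α h • (q - p) + h • n + (-β h - α h) • (q - p) =
      β h • (-(q - p)) + h • n := fun h => by module
  refine ⟨fun h => -β h - α h, fun h => α h • (q - p) + h • n, fun h hh => ?_, fun hpt => ?_,
    fun h hh => ?_⟩
  · have h1 := hαc.continuousAt (isOpen_Ioo.mem_nhds (hsub h hh))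
    have h2 := hβc.continuousAt (isOpen_Ioo.mem_nhds (hsub h hh))
    exact ⟨h2.neg.sub h1, (h1.smul continuousAt_const).add
      (continuousAt_id.smul continuousAt_const)⟩
  · obtain ⟨ha1, ha2⟩ := hα (f p) ⟨hfb, hpt⟩
    obtain ⟨hb1, hb2⟩ := hβ (f p) ⟨hfb, hpt⟩
    have ha3 : α (f p) ≤ g p := ha2 _ (hc.eq_add p ▸ hp)
    have hb3 : β (f p) ≤ -g q := by
      refine hb2 _ ?_
      have h1 := hc.eq_add q
      rw [hfpq] at h1
      have h2 : -g q • (-(q - p)) + f p • n = q := by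
        conv_rhs => rw [h1]
        module
      rw [h2]
      exact hq
    obtain ⟨x, hx0, hx1, hx⟩ := hK.exists_chord_param hc hp hq hp' hq' ha1
      (by simp only [map_add, map_smul, smul_eq_mul, hc.f_d, hc.f_n]; ring)
    obtain ⟨y, hy0, hy1, hy⟩ := hK.exists_chord_param hc hp hq hp' hq' hb1
      (by simp only [map_add, map_smul, map_neg, smul_eq_mul, hc.f_d, hc.f_n]; ring)
    have hx' := congrArg g hx
    have hy' := congrArg g hy
    simp only [map_add, map_smul, map_neg, smul_eq_mul, hc.g_d, hc.g_n] at hx' hy'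
    have hα' : α (f p) = g p := by linarith
    refine ⟨by linarith, ?_⟩
    change α (f p) • (q - p) + f p • n = p
    rw [hα']
    exact (hc.eq_add p).symm
  · obtain ⟨ha1, ha2⟩ := hα h (hsub h hh)
    obtain ⟨hb1, hb2⟩ := hβ h (hsub h hh)
    have ha3 := notMem_interior_of_forall_le ha2
    have hb3 := notMem_interior_of_forall_le hb2
    refine ⟨?_, by simp [hc.f_d, hc.f_n], ha1, ha3, by rw [hv]; exact hb1,
      by rw [hv]; exact hb3⟩
    have hpt : 0 < f t - f p := by linarith [hh.1, hh.2]
    set r := (h - f p) / (f t - f p) with hr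
    have hr0 : 0 ≤ r := div_nonneg (by linarith [hh.1]) hpt.le
    have hr1 : 0 < 1 - r := by
      rw [hr, sub_pos, div_lt_one hpt]
      linarith [hh.2]
    have hint := hK.convex.combo_interior_self_mem_interior hmid ht hr1 hr0 (by ring)
    set c := (1 - r) • ((1 / 2 : ℝ) • p + (1 / 2 : ℝ) • q) + r • t with hcdef
    have hfc : f c = h := by
      rw [hcdef, map_add, map_smul, map_smul, hfmid, smul_eq_mul, smul_eq_mul, hr]
      field_simp
      ring
    have hceq := hc.eq_add c
    rw [hfc] at hceq
    have h1 : α h ≤ g c := ha2 _ (hceq ▸ interior_subset hint)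
    have h2 : β h ≤ -g c := by
      refine hb2 _ ?_
      have : -g c • (-(q - p)) + h • n = c := by
        conv_rhs => rw [hceq]
        module
      rw [this]
      exact interior_subset hint
    have h3 : α h ≠ g c := by
      intro h3
      rw [h3, ← hceq] at ha3
      exact ha3 hint
    have : α h < g c := lt_of_le_of_ne h1 h3
    linarith

/-- If two ranges capture `Y`, the first with `p`, `q` on its boundary and the second with a
further point `r` of `Y` on its boundary, then some range capturing `Y` has `p`, `q` and a third
point of `Y` on its boundary. -/
lemma exists_range_third_boundary_point {S S₁ S₂ X Y : Set Pt} (hS : StrictConvex ℝ S)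
    (hcS : IsCompact S) (h1 : IsRange S S₁) (h2 : IsRange S S₂) (hX : X.Finite)
    (hc1 : X ∩ S₁ = Y) (hc2 : X ∩ S₂ = Y) {g f : Pt →ₗ[ℝ] ℝ} {p q r n : Pt}
    (hc : IsCoord g f (q - p) n) (hp : p ∈ Y) (hq : q ∈ Y) (hr : r ∈ Y)
    (hp' : p ∉ interior S₁) (hq' : q ∉ interior S₁) (hr' : r ∉ interior S₂) (hpr : f p < f r) :
    ∃ T, IsRange S T ∧ X ∩ T = Y ∧ p ∉ interior T ∧ q ∉ interior T ∧
      ∃ y ∈ Y, y ≠ p ∧ y ≠ q ∧ y ∉ interior T := by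
  by_contra! hno
  have hY1 : Y ⊆ S₁ := hc1 ▸ inter_subset_right
  have hY2 : Y ⊆ S₂ := hc2 ▸ inter_subset_right
  have hYX : Y ⊆ X := hc1 ▸ inter_subset_left
  have hfpq : f q = f p := by
    have := hc.f_d
    rw [map_sub] at this
    linarith
  have hd : q - p ≠ 0 := fun h => by simpa [h] using hc.g_d
  have hK := h1.strictConvex hS
  have hcK := h1.isCompact hcS
  have hf : Continuous f := f.continuous_of_finiteDimensional
  obtain ⟨t, ht, htmax⟩ := hcK.exists_isMaxOn ⟨p, hY1 hp⟩ hf.continuousOn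
  obtain ⟨b, hb, hbmin⟩ := hcK.exists_isMinOn ⟨p, hY1 hp⟩ hf.continuousOn
  obtain ⟨b₂, hb₂, hb₂min⟩ :=
    (h2.isCompact hcS).exists_isMinOn ⟨p, hY2 hp⟩ hf.continuousOn
  have hpt : f p < f t := hpr.trans_le (htmax (hY1 hr))
  have hbp : f b < f p := by
    obtain ⟨ε, hε, hmem⟩ := exists_pos_add_smul_mem
      (hK (hY1 hp) (hY1 hq) (fun h => hd (by rw [h, sub_self])) one_half_pos one_half_pos
        (add_halves 1)) (-n)
    have := hbmin hmem
    simp only [mem_ofPred_eq, map_add, map_smul, map_neg, hc.f_n, smul_eq_mul, hfpq] at this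
    linarith
  obtain ⟨l, u, hcont, hinit, hlu⟩ :=
    exists_parallel_chords hK hcK hc (hY1 hp) (hY1 hq) hp' hq' ht
  let θ : ℝ → Pt → Pt := fun h z => l h • z + (u h - l h • p)
  have hθ : ∀ h z, θ h z = u h + l h • (z - p) := fun h z => by simp only [θ]; module
  let T : ℝ → Set Pt := fun h => θ h ⁻¹' S₁
  have hTint : ∀ h ∈ Ico (f p) (f t), interior (T h) = θ h ⁻¹' interior S₁ := fun h hh =>
    interior_homothety_preimage S₁ (hlu h hh).1 _
  have hTr : ∀ h ∈ Ico (f p) (f t), IsRange S (T h) := fun h hh =>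
    h1.preimage (hlu h hh).1 _
  have hθp : ∀ h, θ h p = u h := fun h => by simp [hθ]
  have hpT : ∀ h ∈ Ico (f p) (f t), p ∈ T h ∧ p ∉ interior (T h) := by
    intro h hh
    rw [hTint h hh]
    simp only [T, mem_preimage, hθp]
    exact ⟨(hlu h hh).2.2.1, (hlu h hh).2.2.2.1⟩
  have hqT : ∀ h ∈ Ico (f p) (f t), q ∈ T h ∧ q ∉ interior (T h) := by
    intro h hh
    rw [hTint h hh]
    simp only [T, mem_preimage, hθ]
    exact (hlu h hh).2.2.2.2
  -- the side of `T h` opposite to `r` is contained in `S₂`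
  have hside : ∀ h ∈ Ico (f p) (f t), Y ⊆ T h → ∀ z ∈ T h, f z < f p → z ∈ S₂ := by
    intro h hh hY z hz hfz
    rcases (hTr h hh).side_subset_interior hS h2 hc (hpT h hh).1 (hqT h hh).1 (hpT h hh).2
      (hqT h hh).2 (hY2 hp) (hY2 hq) with hU | hU | hU
    · rwa [hU]
    · exact absurd (hU r (hY hr) hpr) hr'
    · exact interior_subset (hU z hz hfz)
  -- the preimage of the lowest point of `S₁`
  have hbT : ∀ h ∈ Ico (f p) (f t), p + (l h)⁻¹ • (b - u h) ∈ T h ∧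
      f (p + (l h)⁻¹ • (b - u h)) = f p - (h - f b) / l h := by
    intro h hh
    obtain ⟨hl, hfu, -⟩ := hlu h hh
    constructor
    · change θ h _ ∈ S₁
      rw [hθ, add_sub_cancel_left, smul_smul, mul_inv_cancel₀ hl.ne', one_smul,
        add_sub_cancel]
      exact hb
    · rw [map_add, map_smul, map_sub, hfu, smul_eq_mul]
      ring
  have hbT' : ∀ h ∈ Ico (f p) (f t), f (p + (l h)⁻¹ • (b - u h)) < f p := by
    intro h hh
    rw [(hbT h hh).2]
    have : 0 < (h - f b) / l h := div_pos (by linarith [hh.1]) (hlu h hh).1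
    linarith
  have hcapt : ∀ h ∈ Ico (f p) (f t), Y ⊆ T h → X ∩ T h = Y := by
    intro h hh hY
    refine Subset.antisymm ?_ (subset_inter hYX hY)
    rintro x ⟨hxX, hxT⟩
    rcases lt_trichotomy (f x) (f p) with hx | hx | hx
    · exact hc2 ▸ ⟨hxX, hside h hh hY x hxT hx⟩
    · obtain ⟨s, hs0, hs1, rfl⟩ := ((hTr h hh).strictConvex hS).exists_chord_param hc
        (hpT h hh).1 (hqT h hh).1 (hpT h hh).2 (hqT h hh).2 hxT hx
      exact hc1 ▸ ⟨hxX, hK.convex.add_smul_sub_mem (hY1 hp) (hY1 hq) ⟨hs0, hs1⟩⟩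
    · refine hc1 ▸ ⟨hxX, ?_⟩
      rcases (hTr h hh).side_subset_interior hS h1 hc (hpT h hh).1 (hqT h hh).1 (hpT h hh).2
        (hqT h hh).2 (hY1 hp) (hY1 hq) with h' | h' | h'
      · rwa [h']
      · exact interior_subset (h' x hxT hx)
      · exfalso
        obtain ⟨ε, hε, hmem⟩ :=
          exists_pos_add_smul_mem (h' _ (hbT h hh).1 (hbT' h hh)) (-n)
        have hlow := hbmin hmem
        simp only [mem_ofPred_eq, map_add f (p + _) _, (hbT h hh).2, map_smul, map_neg, hc.f_n,
          smul_eq_mul] at hlow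
        obtain ⟨hl, hfu, huK, -, hvK, -⟩ := hlu h hh
        have hhb : 0 < h - f b := by linarith [hh.1]
        set s := (f p - f b) / (h - f b) with hs
        have hs0 : 0 ≤ s := div_nonneg (by linarith) hhb.le
        have hs1 : 0 ≤ 1 - s := by
          rw [hs, sub_nonneg, div_le_one hhb]
          linarith [hh.1]
        have hfs : (1 - s) * f b + s * h = f p := by
          rw [hs]
          field_simp
          ring
        obtain ⟨x₁, hx₁, -, he₁⟩ := hK.exists_chord_param hc (hY1 hp) (hY1 hq) hp' hq'
          (hK.convex hb huK hs1 hs0 (by ring))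
          (by simp only [map_add, map_smul, smul_eq_mul, hfu]; exact hfs)
        obtain ⟨x₂, -, hx₂, he₂⟩ := hK.exists_chord_param hc (hY1 hp) (hY1 hq) hp' hq'
          (hK.convex hb hvK hs1 hs0 (by ring))
          (by simp only [map_add, map_smul, smul_eq_mul, hfu, hc.f_d]; linarith)
        have he : (s * l h) • (q - p) = (x₂ - x₁) • (q - p) := by
          linear_combination (norm := module) he₂ - he₁
        have hsl : s * l h ≤ 1 := by
          rw [smul_left_injective ℝ hd he]
          linarith
        have h3 : (f p - f b) * l h ≤ h - f b := by
          rwa [hs, div_mul_eq_mul_div, div_le_one hhb] at hsl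
        have h4 : f p - f b ≤ (h - f b) / l h := by rwa [le_div_iff₀ hl]
        linarith
  have hall : ∀ h ∈ Ico (f p) (f t), Y ⊆ T h := by
    intro h₁ hh₁
    have hθc : ∀ z, ∀ h ∈ Ico (f p) (f t), ContinuousAt (fun h => θ h z) h := by
      intro z h hh
      obtain ⟨hl, hu⟩ := hcont h hh
      exact (hl.smul continuousAt_const).add (hu.sub (hl.smul continuousAt_const))
    have hsubI : ∀ h ∈ Icc (f p) h₁, h ∈ Ico (f p) (f t) := fun h hh =>
      ⟨hh.1, hh.2.trans_lt hh₁.2⟩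
    have hclosed : IsClosed ({h | Y ⊆ T h} ∩ Icc (f p) h₁) := by
      have heq : {h | Y ⊆ T h} ∩ Icc (f p) h₁ =
          Icc (f p) h₁ ∩ ⋂ y ∈ Y, (Icc (f p) h₁ ∩ (fun h => θ h y) ⁻¹' S₁) := by
        ext h
        simp only [mem_inter_iff, mem_iInter, mem_ofPred_eq, mem_preimage]
        exact ⟨fun ⟨a, b⟩ => ⟨b, fun y hy => ⟨b, a hy⟩⟩, fun ⟨a, b⟩ => ⟨fun y hy => (b y hy).2, a⟩⟩
      rw [heq]
      refine isClosed_Icc.inter (isClosed_biInter fun y _ => ?_)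
      exact ContinuousOn.preimage_isClosed_of_isClosed
        (fun h hh => (hθc y h (hsubI h hh)).continuousWithinAt) isClosed_Icc hcK.isClosed
    refine hclosed.Icc_subset_of_forall_exists_gt ?_ ?_ ⟨hh₁.1, le_rfl⟩
    · intro y hy
      change θ (f p) y ∈ S₁
      rw [hθ, (hinit hpt).1, (hinit hpt).2, one_smul, add_sub_cancel]
      exact hY1 hy
    · rintro h ⟨hYh, hh⟩ h' hh'
      have hhI : h ∈ Ico (f p) (f t) := hsubI h (Ico_subset_Icc_self hh)
      have hev : ∀ᶠ k in nhdsWithin h (Ioi h), ∀ y ∈ Y, θ k y ∈ S₁ := by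
        refine ((hX.subset hYX).eventually_all).2 fun y hy => ?_
        have hI : ∀ᶠ k in nhdsWithin h (Ioi h), k ∈ Ico (f p) (f t) := by
          filter_upwards [Ioo_mem_nhdsGT hhI.2] with k hk
          exact ⟨hhI.1.trans hk.1.le, hk.2⟩
        by_cases hyp : y = p
        · subst hyp
          exact hI.mono fun k hk => (hpT k hk).1
        by_cases hyq : y = q
        · subst hyq
          exact hI.mono fun k hk => (hqT k hk).1
        have hint := hno (T h) (hTr h hhI) (hcapt h hhI hYh) (hpT h hhI).2 (hqT h hhI).2
          y hy hyp hyq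
        rw [hTint h hhI] at hint
        have := (hθc y h hhI).preimage_mem_nhds (isOpen_interior.mem_nhds hint)
        filter_upwards [nhdsWithin_le_nhds this] with k hk using interior_subset hk
      obtain ⟨k, hk, hkm⟩ := (hev.and (Ioc_mem_nhdsGT hh')).exists
      exact ⟨k, fun y hy => hk y hy, hkm⟩
  -- the chord lengths are bounded below, which is absurd near the top of `S₁`
  have hb₂p : f b₂ < f p := by
    have hhp : f p ∈ Ico (f p) (f t) := ⟨le_rfl, hpt⟩
    exact (hb₂min (hside _ hhp (hall _ hhp) _ (hbT _ hhp).1 (hbT' _ hhp))).trans_lt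
      (hbT' _ hhp)
  set μ := (f p - f b) / (f p - f b₂) with hμdef
  have hμ : 0 < μ := div_pos (by linarith) (by linarith)
  have hlb : ∀ h ∈ Ico (f p) (f t), μ ≤ l h := by
    intro h hh
    have h3 := hb₂min (hside h hh (hall h hh) _ (hbT h hh).1 (hbT' h hh))
    rw [mem_ofPred_eq, (hbT h hh).2] at h3
    have hl := (hlu h hh).1
    have h4 : (h - f b) / l h ≤ f p - f b₂ := by linarith
    rw [div_le_iff₀ hl] at h4
    rw [hμdef, div_le_iff₀ (by linarith)]
    linarith [hh.1]
  have hmem : ∀ h ∈ Ico (f p) (f t), u h ∈ S₁ ∩ (fun z => z + μ • (q - p)) ⁻¹' S₁ := by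
    intro h hh
    obtain ⟨hl, -, huK, -, hvK, -⟩ := hlu h hh
    refine ⟨huK, ?_⟩
    have := hK.convex.add_smul_sub_mem huK hvK (t := μ / l h)
      ⟨by positivity, (div_le_one hl).2 (hlb h hh)⟩
    rwa [add_sub_cancel_left, smul_smul, div_mul_cancel₀ _ hl.ne'] at this
  have hC : IsCompact (S₁ ∩ (fun z => z + μ • (q - p)) ⁻¹' S₁) :=
    hcK.inter_right (hcK.isClosed.preimage (by fun_prop))
  obtain ⟨z, ⟨hz, hz'⟩, hzmax⟩ :=
    hC.exists_isMaxOn ⟨_, hmem (f p) ⟨le_rfl, hpt⟩⟩ hf.continuousOn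
  have hzt : f z < f t := by
    obtain ⟨ε, hε, hm⟩ := exists_pos_add_smul_mem
      (hK hz hz' (fun h => (smul_ne_zero hμ.ne' hd) (left_eq_add.1 h)) one_half_pos one_half_pos
        (add_halves 1)) n
    have := htmax hm
    simp only [mem_ofPred_eq, map_add, map_smul, hc.f_n, hc.f_d, smul_eq_mul] at this
    linarith
  have hmax : max (f z) (f p) < f t := max_lt hzt hpt
  have hhI : (max (f z) (f p) + f t) / 2 ∈ Ico (f p) (f t) :=
    ⟨by linarith [le_max_right (f z) (f p)], by linarith⟩
  have := hzmax (hmem _ hhI)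
  rw [mem_ofPred_eq, (hlu _ hhI).2.1] at this
  linarith [le_max_left (f z) (f p)]

/-- all Type II representative `S`-ranges for the same hyperedge
have the same pair of points of `X` on their boundary. -/
theorem typeII_representatives_same_boundary_pair
    (S : Set Pt) (hS : NiceShape S) (X : Finset Pt) (hX : GenPos S X)
    (Y : Set Pt)
    (hnoI : ∀ T : Set Pt, IsRange S T → ↑X ∩ T = Y →
      ((↑X : Set Pt) ∩ frontier T).ncard < 3)
    (S₁ S₂ : Set Pt) (h1 : IsRange S S₁) (h2 : IsRange S S₂)
    (hc1 : ↑X ∩ S₁ = Y) (hc2 : ↑X ∩ S₂ = Y)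
    (hb1 : ((↑X : Set Pt) ∩ frontier S₁).ncard = 2)
    (hb2 : ((↑X : Set Pt) ∩ frontier S₂).ncard = 2) :
    (↑X : Set Pt) ∩ frontier S₁ = (↑X : Set Pt) ∩ frontier S₂ := by
  have hSc := hS.strictConvex
  have hcS : IsCompact S := hS.2.2.1
  have hfin : ∀ T : Set Pt, ((↑X : Set Pt) ∩ T).Finite := fun T =>
    X.finite_toSet.subset inter_subset_left
  have hfr : ∀ T, IsRange S T → ∀ x, x ∈ frontier T ↔ x ∈ T ∧ x ∉ interior T := by
    intro T hT x
    rw [(hT.isCompact hcS).isClosed.frontier_eq, mem_sdiff]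
  by_contra hne
  obtain ⟨p, q, hpq, hpqe⟩ := ncard_eq_two.1 hb1
  obtain ⟨r, ⟨hrX, hrF⟩, hr⟩ : ∃ r ∈ (↑X : Set Pt) ∩ frontier S₂,
      r ∉ (↑X : Set Pt) ∩ frontier S₁ := by
    by_contra! hsub
    exact hne (eq_of_subset_of_ncard_le hsub (by rw [hb1, hb2]) (hfin _)).symm
  obtain ⟨hpX, hpF⟩ : p ∈ (↑X : Set Pt) ∩ frontier S₁ := by simp [hpqe]
  obtain ⟨hqX, hqF⟩ : q ∈ (↑X : Set Pt) ∩ frontier S₁ := by simp [hpqe]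
  rw [hpqe, mem_insert_iff, mem_singleton_iff, not_or] at hr
  rw [hfr S₁ h1] at hpF hqF
  rw [hfr S₂ h2] at hrF
  have hp : p ∈ Y := hc1 ▸ ⟨hpX, hpF.1⟩
  have hq : q ∈ Y := hc1 ▸ ⟨hqX, hqF.1⟩
  have hrY : r ∈ Y := hc2 ▸ ⟨hrX, hrF.1⟩
  obtain ⟨g, f, n, hc⟩ := exists_isCoord (sub_ne_zero.2 hpq.symm)
  have hfr' : f r ≠ f p := by
    intro h
    obtain ⟨t, ht0, ht1, ht⟩ := (h1.strictConvex hSc).exists_chord_param hc hpF.1 hqF.1 hpF.2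
      hqF.2 (hc1 ▸ hrY : r ∈ (↑X : Set Pt) ∩ S₁).2 h
    have ht0' : 0 < t := lt_of_le_of_ne ht0 (by rintro rfl; simp [hr.1] at ht)
    have ht1' : t < 1 := lt_of_le_of_ne ht1 (by rintro rfl; simp [hr.2] at ht)
    refine hrF.2 ((h2.strictConvex hSc).combo_mem_interior
      (hc2 ▸ hp : p ∈ (↑X : Set Pt) ∩ S₂).2 (hc2 ▸ hq : q ∈ (↑X : Set Pt) ∩ S₂).2
      (sub_pos.2 ht1') ht0' (by ring) ?_ hr.1)
    rw [ht]
    module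
  obtain ⟨T, hT, hTY, hpT, hqT, y, hy, hyp, hyq, hyT⟩ : ∃ T, IsRange S T ∧ ↑X ∩ T = Y ∧
      p ∉ interior T ∧ q ∉ interior T ∧ ∃ y ∈ Y, y ≠ p ∧ y ≠ q ∧ y ∉ interior T := by
    rcases lt_or_gt_of_ne hfr' with h | h
    · exact exists_range_third_boundary_point hSc hcS h1 h2 X.finite_toSet hc1 hc2 hc.flip
        hp hq hrY hpF.2 hqF.2 hrF.2 (by simpa using h)
    · exact exists_range_third_boundary_point hSc hcS h1 h2 X.finite_toSet hc1 hc2 hc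
        hp hq hrY hpF.2 hqF.2 hrF.2 h
  have hmem : ∀ z ∈ Y, z ∉ interior T → z ∈ (↑X : Set Pt) ∩ frontier T := by
    intro z hz hzT
    rw [← hTY] at hz
    exact ⟨hz.1, (hfr T hT z).2 ⟨hz.2, hzT⟩⟩
  have hthree : ({y, p, q} : Set Pt) ⊆ (↑X : Set Pt) ∩ frontier T := by
    rintro z (rfl | rfl | rfl)
    exacts [hmem _ hy hyT, hmem _ hp hpT, hmem _ hq hqT]
  have hcard := ncard_le_ncard hthree (hfin _)
  rw [ncard_eq_three.2 ⟨y, p, q, hyp, hyq, hpq, rfl⟩] at hcard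
  exact absurd (hnoI T hT hTY) (by omega)
end
end

section
/- Let S ⊆ ℝ² be a nice shape and let X ⊆ ℝ² be a finite point set in general position with respect to S. Let S₁ and S₂ be S-ranges with X ∩ S₁ = X ∩ S₂, let x₁, y₁ be two distinct points of X ∩ ∂S₁ and let x₂, y₂ be two distinct points of X ∩ ∂S₂ such that {x₁, y₁} ∩ {x₂, y₂} = ∅. Then the closed straight-line segments [x₁, y₁] and [x₂, y₂] are disjoint. -/
open Set

noncomputable section

/-- A family of sign conditions on a vector `(p, q)` and a scalar `e` which is only satisfied
trivially: the conditions express that the field `x ↦ (p, q) + e • x` points outward at the ends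
`(β, 0)`, `(-α, 0)` and inward at the ends `(0, δ)`, `(0, -γ)` of two crossing segments, relative
to lines which strictly support the quadrilateral at its vertices. -/
lemma crossing_field_eq_zero {α β γ δ p q e f f' g g' : ℝ}
    (hα : 0 < α) (hβ : 0 < β) (hγ : 0 < γ) (hδ : 0 < δ)
    (hf₁ : δ * f < β) (hf₂ : -γ * f < β) (hf : 0 ≤ p + e * β + f * q)
    (hf₁' : δ * f' < α) (hf₂' : -γ * f' < α) (hf' : 0 ≤ -p + e * α + f' * q)
    (hg₁ : β * g < δ) (hg₂ : -α * g < δ) (hg : p * g + q + e * δ ≤ 0)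
    (hg₁' : β * g' < γ) (hg₂' : -α * g' < γ) (hg' : p * g' - q + e * γ ≤ 0) :
    p = 0 ∧ q = 0 ∧ e = 0 := by
  rcases lt_trichotomy p 0 with hp | rfl | hp
  · exfalso
    have h₁ : 0 < -p * (δ - β * g) := mul_pos (by linarith) (by linarith)
    have h₂ : 0 < -p * (γ - β * g') := mul_pos (by linarith) (by linarith)
    have h₃ := mul_nonneg hβ.le (neg_nonneg.2 hg)
    have h₄ := mul_nonneg hβ.le (neg_nonneg.2 hg')
    rcases le_total 0 q with hq | hq
    · have h₅ : 0 ≤ q * (β - δ * f) := mul_nonneg hq (by linarith)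
      have h₆ := mul_nonneg hδ.le hf
      linarith
    · have h₅ : 0 ≤ -q * (β + γ * f) := mul_nonneg (by linarith) (by linarith)
      have h₆ := mul_nonneg hγ.le hf
      linarith
  · rcases lt_trichotomy q 0 with hq | rfl | hq
    · exfalso
      have h₅ : 0 < -q * (β + γ * f) := mul_pos (by linarith) (by linarith)
      have h₆ := mul_nonneg hγ.le hf
      have h₄ := mul_nonneg hβ.le (neg_nonneg.2 hg')
      linarith
    · refine ⟨rfl, rfl, le_antisymm ?_ ?_⟩
      · exact nonpos_of_mul_nonpos_left (by linarith) hδ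
      · exact nonneg_of_mul_nonneg_left (by linarith : 0 ≤ e * β) hβ
    · exfalso
      have h₅ : 0 < q * (β - δ * f) := mul_pos hq (by linarith)
      have h₆ := mul_nonneg hδ.le hf
      have h₃ := mul_nonneg hβ.le (neg_nonneg.2 hg)
      linarith
  · exfalso
    have h₁ : 0 < p * (δ + α * g) := mul_pos hp (by linarith)
    have h₂ : 0 < p * (γ + α * g') := mul_pos hp (by linarith)
    have h₃ := mul_nonneg hα.le (neg_nonneg.2 hg)
    have h₄ := mul_nonneg hα.le (neg_nonneg.2 hg')
    rcases le_total 0 q with hq | hq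
    · have h₅ : 0 ≤ q * (α - δ * f') := mul_nonneg hq (by linarith)
      have h₆ := mul_nonneg hδ.le hf'
      linarith
    · have h₅ : 0 ≤ -q * (α + γ * f') := mul_nonneg (by linarith) (by linarith)
      have h₆ := mul_nonneg hγ.le hf'
      linarith

/-- Every boundary point of a range of a nice shape is the unique maximizer over the range of
some linear functional, as soon as the range has a second point. -/
lemma NiceShape.exists_forall_lt {S T : Set Pt} (hS : NiceShape S) (hT : IsRange S T)
    {x y : Pt} (hx : x ∈ frontier T) (hy : y ∈ T) (hxy : x ≠ y) :
    ∃ f : Pt →ₗ[ℝ] ℝ, ∀ q ∈ T, q ≠ x → f q < f x := by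
  obtain ⟨-, hconv, hcomp, -, hseg⟩ := hS
  obtain ⟨c, v, hc, rfl⟩ := hT
  have hfr : frontier ((fun x : Pt => c • x + v) '' S) = (fun x : Pt => c • x + v) '' frontier S :=
    (((Homeomorph.smulOfNeZero c hc.ne').trans (Homeomorph.addRight v)).image_frontier S).symm
  rw [hfr] at hx
  obtain ⟨x, hx, rfl⟩ := hx
  obtain ⟨y, hy, rfl⟩ := hy
  have hxS : x ∈ S := hcomp.isClosed.frontier_subset hx
  have hxy' : x ≠ y := fun h => hxy (by rw [h])
  have hint : (interior S).Nonempty := by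
    by_contra h
    rw [not_nonempty_iff_eq_empty] at h
    have hfS : frontier S = S := by rw [hcomp.isClosed.frontier_eq, h, sdiff_empty]
    exact hxy' (hseg x hx y (hfS.ge hy) ((hconv.segment_subset hxS hy).trans hfS.ge))
  obtain ⟨f, hf⟩ := geometric_hahn_banach_open_point hconv.interior isOpen_interior hx.2
  have hle : ∀ q ∈ S, f q ≤ f x := by
    intro q hq
    have hq' : q ∈ closure (interior S) := by
      rw [hconv.closure_interior_eq_closure_of_nonempty_interior hint]
      exact subset_closure hq
    exact closure_minimal (fun z hz => (hf z hz).le)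
      (isClosed_le f.continuous continuous_const) hq'
  have hmax : ∀ q ∈ S, f q = f x → q ∈ frontier S := fun q hq h =>
    ⟨subset_closure hq, fun hi => (hf q hi).ne h⟩
  refine ⟨f.toLinearMap, ?_⟩
  rintro _ ⟨q, hq, rfl⟩ hne
  have hlt : f q < f x := by
    refine lt_of_le_of_ne (hle q hq) fun h => hne ?_
    rw [hseg x hx q (hmax q hq h) ?_]
    intro z hz
    refine hmax z (hconv.segment_subset hxS hq hz) ?_
    obtain ⟨a, b, -, -, hab, rfl⟩ := hz
    simp only [map_add, map_smul, smul_eq_mul, h]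
    rw [← add_mul, hab, one_mul]
  have := mul_lt_mul_of_pos_left hlt hc
  simpa using this

/-- If a functional attains its maximum over the homothet `c₁ • S + v₁` at a point of the
homothet `c₂ • S + v₂`, then the displacement field of the homothety between the two does not
point inward there. -/
lemma displacement_nonneg {S : Set Pt} {c₁ c₂ : ℝ} {v₁ v₂ x : Pt} (hc₂ : 0 < c₂)
    {f : Pt →ₗ[ℝ] ℝ} (hf : ∀ q ∈ (fun x => c₁ • x + v₁) '' S, q ≠ x → f q < f x)
    (hx : x ∈ (fun x => c₂ • x + v₂) '' S) :
    0 ≤ f ((c₂ - c₁) • x + (c₁ • v₂ - c₂ • v₁)) := by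
  obtain ⟨s, hs, rfl⟩ := hx
  have hle : f (c₁ • s + v₁) ≤ f (c₂ • s + v₂) := by
    by_cases h : c₁ • s + v₁ = c₂ • s + v₂
    · rw [h]
    · exact (hf _ ⟨s, hs, rfl⟩ h).le
  simp only [map_add, map_sub, map_smul, smul_eq_mul] at hle ⊢
  nlinarith [mul_nonneg hc₂.le (sub_nonneg.2 hle)]

/-- A functional on the plane which is positive at `a` can be rescaled to take the value `1`
there. -/
lemma exists_pos_smul_eq_one {f : Pt →ₗ[ℝ] ℝ} {a : Pt} (ha : 0 < f a) :
    ∃ t : ℝ, 0 < t ∧ (t • f) a = 1 :=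
  ⟨(f a)⁻¹, inv_pos.2 ha, by simp [ha.ne']⟩

/-- A nonzero field `x ↦ w + e • x` cannot point weakly outward at both ends of one segment and
weakly inward at both ends of another one crossing it, when the four ends are strictly extremal.
Here the ends are `β • a`, `-α • a` and `δ • b`, `-γ • b`. -/
lemma field_eq_zero_of_functionals {a b w : Pt} {α β γ δ e : ℝ}
    (hα : 0 < α) (hβ : 0 < β) (hγ : 0 < γ) (hδ : 0 < δ)
    {f f' g g' : Pt →ₗ[ℝ] ℝ}
    (hfa : f a = 1) (hf₁ : δ * f b < β) (hf₂ : -γ * f b < β) (hf : 0 ≤ f w + e * β)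
    (hfa' : f' a = -1) (hf₁' : δ * f' b < α) (hf₂' : -γ * f' b < α) (hf' : 0 ≤ f' w + e * α)
    (hgb : g b = 1) (hg₁ : β * g a < δ) (hg₂ : -α * g a < δ) (hg : g w + e * δ ≤ 0)
    (hgb' : g' b = -1) (hg₁' : β * g' a < γ) (hg₂' : -α * g' a < γ) (hg' : g' w + e * γ ≤ 0) :
    w = 0 ∧ e = 0 := by
  have key : ∀ p q e : ℝ, 0 ≤ f (p • a + q • b) + e * β → 0 ≤ f' (p • a + q • b) + e * α →
      g (p • a + q • b) + e * δ ≤ 0 → g' (p • a + q • b) + e * γ ≤ 0 →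
      p = 0 ∧ q = 0 ∧ e = 0 := by
    intro p q e h₁ h₂ h₃ h₄
    simp only [map_add, map_smul, smul_eq_mul, hfa, hfa', hgb, hgb'] at h₁ h₂ h₃ h₄
    exact crossing_field_eq_zero hα hβ hγ hδ hf₁ hf₂ (by linarith) hf₁' hf₂' (by linarith)
      hg₁ hg₂ (by linarith) hg₁' hg₂' (by linarith)
  have hli : LinearIndependent ℝ ![a, b] := by
    rw [LinearIndependent.pair_iff]
    intro s t hst
    have := key s t 0 (by simp [hst]) (by simp [hst]) (by simp [hst]) (by simp [hst])
    exact ⟨this.1, this.2.1⟩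
  have hspan : Submodule.span ℝ (Set.range ![a, b]) = ⊤ :=
    hli.span_eq_top_of_card_eq_finrank (by simp)
  have hw : w ∈ Submodule.span ℝ ({a, b} : Set Pt) := by
    have : w ∈ Submodule.span ℝ (Set.range ![a, b]) := hspan ▸ Submodule.mem_top
    simpa [Matrix.range_cons, Matrix.range_empty, Set.pair_comm] using this
  obtain ⟨p, q, rfl⟩ := Submodule.mem_span_pair.1 hw
  obtain ⟨rfl, rfl, he⟩ := key p q e hf hf' hg hg'
  exact ⟨by simp, he⟩

/-- A point strictly above two others for a functional is not a convex combination of them: in a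
crossing `α • x + β • y = γ • x' + δ • y'`, the coefficient `β` is positive. -/
lemma pos_of_crossing {x y x' y' : Pt} {α β γ δ : ℝ} (hβ : 0 ≤ β)
    (hγ : 0 ≤ γ) (hδ : 0 ≤ δ) (hαβ : α + β = 1) (hγδ : γ + δ = 1)
    (hz : γ • x' + δ • y' = α • x + β • y)
    {f : Pt →ₗ[ℝ] ℝ} (hx' : f x' < f x) (hy' : f y' < f x) : 0 < β := by
  refine lt_of_le_of_ne hβ fun h => ?_
  subst h
  obtain rfl : α = 1 := by linarith
  have := congrArg f hz
  simp only [map_add, map_smul, smul_eq_mul, one_mul, zero_mul, add_zero] at this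
  rcases hγ.eq_or_lt with rfl | hγ'
  · obtain rfl : δ = 1 := by linarith
    linarith
  · obtain rfl : δ = 1 - γ := by linarith
    linarith [mul_pos hγ' (sub_pos.2 hx'), mul_nonneg hδ (sub_pos.2 hy').le]

/-- Rescaled form of strict extremality of `x` among the ends of two crossing segments, in
coordinates centered at the crossing point. -/
lemma exists_normalized_functional {x y x' y' w : Pt} {α β γ δ e : ℝ}
    (hαβ : α + β = 1) (hγδ : γ + δ = 1)
    (hz : γ • x' + δ • y' = α • x + β • y)
    {f : Pt →ₗ[ℝ] ℝ} (hy : f y < f x) (hx' : f x' < f x) (hy' : f y' < f x)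
    (hw : 0 ≤ f (w + e • x)) :
    ∃ g : Pt →ₗ[ℝ] ℝ, g (x - y) = 1 ∧ δ * g (x' - y') < β ∧ -γ * g (x' - y') < β ∧
      0 ≤ g (w + e • (α • x + β • y)) + e * β := by
  obtain ⟨t, ht, h1⟩ := exists_pos_smul_eq_one (f := f) (a := x - y) (by simpa using hy)
  have hx'' := mul_lt_mul_of_pos_left hx' ht
  have hy'' := mul_lt_mul_of_pos_left hy' ht
  have hw' := mul_nonneg ht.le hw
  have hz' := congrArg (t • f) hz
  refine ⟨t • f, h1, ?_⟩
  simp only [LinearMap.smul_apply, map_add, map_sub, map_smul, smul_eq_mul] at *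
  obtain rfl : α = 1 - β := by linarith
  obtain rfl : γ = 1 - δ := by linarith
  have hβ : t * f x - β = t * ((1 - β) * f x + β * f y) := by linear_combination β * h1
  refine ⟨by linarith, by linarith, ?_⟩
  have : t * (f w + e * ((1 - β) * f x + β * f y)) + e * β = t * (f w + e * f x) := by
    linear_combination (-e * β) * h1
  linarith

/-- if two `S`-ranges capture the same subset of `X`, then segments
joining pairs of boundary points of `X` on the respective ranges, with disjoint
endpoint sets, are disjoint. -/
theorem boundary_segments_disjoint
    (S : Set Pt) (hS : NiceShape S) (X : Finset Pt) (hX : GenPos S X)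
    (S₁ S₂ : Set Pt) (h1 : IsRange S S₁) (h2 : IsRange S S₂)
    (hcap : ↑X ∩ S₁ = ↑X ∩ S₂)
    (x₁ y₁ x₂ y₂ : Pt)
    (hx₁ : x₁ ∈ (↑X : Set Pt) ∩ frontier S₁) (hy₁ : y₁ ∈ (↑X : Set Pt) ∩ frontier S₁)
    (hx₂ : x₂ ∈ (↑X : Set Pt) ∩ frontier S₂) (hy₂ : y₂ ∈ (↑X : Set Pt) ∩ frontier S₂)
    (h11 : x₁ ≠ y₁) (h22 : x₂ ≠ y₂)
    (hdisj : ({x₁, y₁} : Set Pt) ∩ {x₂, y₂} = ∅) :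
    Disjoint (segment ℝ x₁ y₁) (segment ℝ x₂ y₂) := by
  rw [Set.disjoint_left]
  rintro z ⟨α, β, hα, hβ, hαβ, rfl⟩ ⟨γ, δ, hγ, hδ, hγδ, hz⟩
  have hmem : ∀ {T : Set Pt}, IsRange S T → frontier T ⊆ T := by
    rintro T ⟨c, v, -, rfl⟩
    have hcl : IsClosed ((fun x : Pt => c • x + v) '' S) :=
      (hS.2.2.1.image (by fun_prop)).isClosed
    exact hcl.frontier_subset
  have hx₁S := hmem h1 hx₁.2
  have hy₁S := hmem h1 hy₁.2
  have hx₂S := hmem h2 hx₂.2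
  have hy₂S := hmem h2 hy₂.2
  have hx₁S' : x₁ ∈ S₂ := (hcap.le ⟨hx₁.1, hx₁S⟩).2
  have hy₁S' : y₁ ∈ S₂ := (hcap.le ⟨hy₁.1, hy₁S⟩).2
  have hx₂S' : x₂ ∈ S₁ := (hcap.ge ⟨hx₂.1, hx₂S⟩).2
  have hy₂S' : y₂ ∈ S₁ := (hcap.ge ⟨hy₂.1, hy₂S⟩).2
  have hne : x₁ ≠ x₂ ∧ x₁ ≠ y₂ ∧ y₁ ≠ x₂ ∧ y₁ ≠ y₂ := by
    have hd := Set.disjoint_iff_inter_eq_empty.2 hdisj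
    refine ⟨hd.ne_of_mem ?_ ?_, hd.ne_of_mem ?_ ?_, hd.ne_of_mem ?_ ?_, hd.ne_of_mem ?_ ?_⟩ <;> simp
  obtain ⟨hxx, hxy, hyx, hyy⟩ := hne
  obtain ⟨f, hf⟩ := hS.exists_forall_lt h1 hx₁.2 hy₁S h11
  obtain ⟨f', hf'⟩ := hS.exists_forall_lt h1 hy₁.2 hx₁S h11.symm
  obtain ⟨g, hg⟩ := hS.exists_forall_lt h2 hx₂.2 hy₂S h22
  obtain ⟨g', hg'⟩ := hS.exists_forall_lt h2 hy₂.2 hx₂S h22.symm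
  have hz₁ : γ • x₂ + δ • y₂ = β • y₁ + α • x₁ := by rw [hz, add_comm]
  have hz₂ : β • y₁ + α • x₁ = γ • x₂ + δ • y₂ := hz₁.symm
  have hz₃ : α • x₁ + β • y₁ = δ • y₂ + γ • x₂ := by rw [← hz, add_comm]
  have hβ' := pos_of_crossing hβ hγ hδ hαβ hγδ hz (hf _ hx₂S' hxx.symm) (hf _ hy₂S' hxy.symm)
  have hα' := pos_of_crossing hα hγ hδ (by linarith) hγδ hz₁
    (hf' _ hx₂S' hyx.symm) (hf' _ hy₂S' hyy.symm)
  have hδ' := pos_of_crossing hδ hα hβ hγδ hαβ hz.symm (hg _ hx₁S' hxx) (hg _ hy₁S' hyx)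
  have hγ' := pos_of_crossing hγ hα hβ (by linarith) hαβ hz₃ (hg' _ hx₁S' hxy) (hg' _ hy₁S' hyy)
  obtain ⟨c₁, v₁, hc₁, rfl⟩ := h1
  obtain ⟨c₂, v₂, hc₂, rfl⟩ := h2
  have hf₀ := displacement_nonneg hc₂ hf hx₁S'
  have hf₀' := displacement_nonneg hc₂ hf' hy₁S'
  have hg₀ := displacement_nonneg hc₁ hg hx₂S'
  have hg₀' := displacement_nonneg hc₁ hg' hy₂S'
  rw [add_comm] at hf₀ hf₀' hg₀ hg₀'
  obtain ⟨F, hF, hF₁, hF₂, hF₃⟩ := exists_normalized_functional hαβ hγδ hz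
    (hf _ hy₁S h11.symm) (hf _ hx₂S' hxx.symm) (hf _ hy₂S' hxy.symm) hf₀
  obtain ⟨F', hF', hF₁', hF₂', hF₃'⟩ := exists_normalized_functional (by linarith) hγδ hz₁
    (hf' _ hx₁S h11) (hf' _ hx₂S' hyx.symm) (hf' _ hy₂S' hyy.symm) hf₀'
  obtain ⟨G, hG, hG₁, hG₂, hG₃⟩ := exists_normalized_functional hγδ hαβ hz.symm
    (hg _ hy₂S h22.symm) (hg _ hx₁S' hxx) (hg _ hy₁S' hyx) hg₀
  obtain ⟨G', hG', hG₁', hG₂', hG₃'⟩ := exists_normalized_functional (by linarith) hαβ hz₃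
    (hg' _ hx₂S h22) (hg' _ hx₁S' hxy) (hg' _ hy₁S' hyy) hg₀'
  rw [← hz₁, hz] at hF₃'
  rw [hz] at hG₃
  rw [← hz₃] at hG₃'
  have hneg : ∀ z : Pt, c₂ • v₁ - c₁ • v₂ + (c₁ - c₂) • z
      = -(c₁ • v₂ - c₂ • v₁ + (c₂ - c₁) • z) := fun z => by module
  rw [hneg, map_neg] at hG₃ hG₃'
  obtain ⟨hw, he⟩ := field_eq_zero_of_functionals hα' hβ' hγ' hδ' hF hF₁ hF₂ hF₃
    (by rw [← neg_sub y₁ x₁, map_neg, hF']) hF₁' hF₂' hF₃' hG hG₁ hG₂ (by linarith)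
    (by rw [← neg_sub y₂ x₂, map_neg, hG']) hG₁' hG₂' (by linarith)
  obtain rfl : c₂ = c₁ := by linarith
  have hv : v₁ = v₂ := by
    rw [he, zero_smul, add_zero, ← smul_sub, smul_eq_zero, sub_eq_zero] at hw
    exact (hw.resolve_left hc₂.ne').symm
  subst hv
  exact hX.2.2 _ ⟨c₂, v₁, hc₂, rfl⟩ x₁ y₁ x₂ y₂ hx₁ hy₁ hx₂ hy₂ h11 hxx hxy hyx hyy h22
end
end
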